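/- arXiv:1607.05067 — 2 statements merged into one kernel-verified Lean document; each statement's English description precedes it below -/
import Mathlib

section
/- Let -1 ≤ B < A ≤ 1, f ∈ S*(A,B), δ = (1-A)/(1-B), and F(w) = w + Σ_{n≥2} A_n wⁿ the inverse of f near the origin. Fix n ≥ 2 and suppose k/n ≤ δ < (k+1)/n for some k ∈ {2,...,n-2}. Then |A_n| ≤ ((n-k)/(n(n-1)))·Π_{j=0}^{n-k-1} (n(A-B)+Bj)/(j+1). -/
open Metric Complex

/-- The class `S*(A,B)`. -/
def IsJanowskiStarlike (A B : ℝ) (f : ℂ → ℂ) : Prop :=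
  AnalyticOn ℂ f (ball 0 1) ∧ f 0 = 0 ∧ deriv f 0 = 1 ∧
    ∃ ω : ℂ → ℂ, AnalyticOn ℂ ω (ball 0 1) ∧ (∀ z ∈ ball (0 : ℂ) 1, ‖ω z‖ ≤ 1) ∧
      ∀ z ∈ ball (0 : ℂ) 1,
        z * deriv f z * (1 + (B : ℂ) * z * ω z) = f z * (1 + (A : ℂ) * z * ω z)

/-- `a` is the sequence of Taylor coefficients of the branch of `(f z / z) ^ (-lam)`
normalized to equal `1` at the origin. -/
def NegPowCoeff (lam : ℝ) (f : ℂ → ℂ) (a : ℕ → ℂ) : Prop :=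
  ∃ h : ℂ → ℂ, AnalyticOn ℂ h (ball 0 1) ∧ h 0 = 0 ∧
    (∀ z ∈ ball (0 : ℂ) 1, f z = z * Complex.exp (h z)) ∧
    a 0 = 1 ∧
    ∀ z ∈ ball (0 : ℂ) 1,
      HasSum (fun n : ℕ => a n * z ^ n) (Complex.exp (-(lam : ℂ) * h z))

/-- Taylor series at the origin. -/
noncomputable def taylorPS (h : ℂ → ℂ) : PowerSeries ℂ :=
  PowerSeries.mk fun m => iteratedDeriv m h 0 / (m.factorial : ℂ)

lemma taylorPS_congr {g h : ℂ → ℂ} (e : g =ᶠ[nhds 0] h) : taylorPS g = taylorPS h := by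
  ext m
  simp [taylorPS, e.iteratedDeriv_eq m]

lemma taylorPS_mul {g h : ℂ → ℂ} (hg : AnalyticAt ℂ g 0) (hh : AnalyticAt ℂ h 0) :
    taylorPS (fun z => g z * h z) = taylorPS g * taylorPS h := by
  ext m
  have := iteratedDeriv_mul (n := m) (x := (0:ℂ)) hg.contDiffAt hh.contDiffAt
  rw [PowerSeries.coeff_mul, Finset.Nat.sum_antidiagonal_eq_sum_range_succ_mk]
  simp only [taylorPS, PowerSeries.coeff_mk]
  change iteratedDeriv m (g * h) 0 / _ = _
  rw [this, Finset.sum_div]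
  refine Finset.sum_congr rfl fun i hi => ?_
  have hi' : i ≤ m := by simpa [Nat.lt_succ_iff] using hi
  rw [Nat.cast_choose ℂ hi']
  have h1 : (m.factorial : ℂ) ≠ 0 := by exact_mod_cast m.factorial_ne_zero
  have h2 : (i.factorial : ℂ) ≠ 0 := by exact_mod_cast i.factorial_ne_zero
  have h3 : ((m - i).factorial : ℂ) ≠ 0 := by exact_mod_cast (m - i).factorial_ne_zero
  field_simp

lemma taylorPS_add {g h : ℂ → ℂ} (hg : AnalyticAt ℂ g 0) (hh : AnalyticAt ℂ h 0) :
    taylorPS (fun z => g z + h z) = taylorPS g + taylorPS h := by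
  ext m
  have := iteratedDeriv_add (n := m) (x := (0:ℂ)) hg.contDiffAt hh.contDiffAt
  simp only [taylorPS, PowerSeries.coeff_mk, map_add]
  change iteratedDeriv m (g + h) 0 / _ = _
  rw [this, add_div]

lemma taylorPS_const (c : ℂ) : taylorPS (fun _ => c) = PowerSeries.C c := by
  ext m
  simp only [taylorPS, PowerSeries.coeff_mk, iteratedDeriv_const, PowerSeries.coeff_C]
  split_ifs with h <;> simp [h]

lemma taylorPS_id : taylorPS (fun z => z) = PowerSeries.X := by
  ext m
  simp only [taylorPS, PowerSeries.coeff_mk, PowerSeries.coeff_X]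
  rcases m with _ | _ | m
  · simp
  · simp
  · rw [iteratedDeriv_succ', iteratedDeriv_succ']
    simp

lemma taylorPS_pow {g : ℂ → ℂ} (hg : AnalyticAt ℂ g 0) (m : ℕ) :
    taylorPS (fun z => g z ^ m) = taylorPS g ^ m := by
  induction m with
  | zero => simpa using taylorPS_const 1
  | succ m ih =>
    simp only [pow_succ]
    rw [taylorPS_mul (hg.fun_pow m) hg, ih]

lemma taylorPS_sum {g : ℕ → ℂ → ℂ} (hg : ∀ i, AnalyticAt ℂ (g i) 0) (m : ℕ) :
    taylorPS (fun z => ∑ i ∈ Finset.range m, g i z) = ∑ i ∈ Finset.range m, taylorPS (g i) := by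
  induction m with
  | zero => simpa using taylorPS_const 0
  | succ m ih =>
    simp only [Finset.sum_range_succ]
    rw [taylorPS_add (Finset.analyticAt_fun_sum _ fun i _ => hg i) (hg m), ih]

lemma taylorPS_deriv (g : ℂ → ℂ) :
    taylorPS (deriv g) = PowerSeries.derivative ℂ (taylorPS g) := by
  ext m
  simp only [taylorPS, PowerSeries.coeff_mk, PowerSeries.coeff_derivative]
  rw [← iteratedDeriv_succ', Nat.factorial_succ]
  have := Nat.factorial_ne_zero m
  push_cast
  have h : (m : ℂ) + 1 ≠ 0 := by exact_mod_cast m.succ_ne_zero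
  field_simp

lemma taylorPS_coeff_zero (g : ℂ → ℂ) : PowerSeries.coeff 0 (taylorPS g) = g 0 := by
  simp [taylorPS]

lemma exists_decomp {r : ℝ} (hr : 0 < r) (p : ℕ) :
    ∀ {h : ℂ → ℂ}, DifferentiableOn ℂ h (ball 0 r) →
    ∃ R : ℂ → ℂ, DifferentiableOn ℂ R (ball 0 r) ∧ ∀ z ∈ ball (0:ℂ) r, h z =
      ∑ m ∈ Finset.range p, PowerSeries.coeff m (taylorPS h) * z ^ m + z ^ p * R z := by
  induction p with
  | zero => intro h hh; exact ⟨h, hh, by simp⟩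
  | succ p ih =>
    intro h hh
    have hnb : ball (0:ℂ) r ∈ nhds (0:ℂ) := ball_mem_nhds _ hr
    have hd : DifferentiableOn ℂ (dslope h 0) (ball 0 r) :=
      (Complex.differentiableOn_dslope hnb).2 hh
    obtain ⟨R, hR, e⟩ := ih hd
    have key : h = fun z => h 0 + z * dslope h 0 z := by
      funext z
      have := sub_smul_dslope h 0 z
      simp only [sub_zero, smul_eq_mul] at this
      rw [this]; ring
    have ha : AnalyticAt ℂ (dslope h 0) 0 := hd.analyticAt hnb
    have kT : taylorPS h = PowerSeries.C (h 0) + PowerSeries.X * taylorPS (dslope h 0) := by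
      conv_lhs => rw [key]
      have hi : AnalyticAt ℂ (fun z : ℂ => z) 0 := by fun_prop
      rw [taylorPS_add analyticAt_const (hi.fun_mul ha), taylorPS_const,
        taylorPS_mul hi ha, taylorPS_id]
    refine ⟨R, hR, fun z hz => ?_⟩
    rw [Finset.sum_range_succ', taylorPS_coeff_zero]
    have : ∀ m, PowerSeries.coeff (m+1) (taylorPS h) = PowerSeries.coeff m (taylorPS (dslope h 0)) := by
      intro m
      rw [kT]; simp [PowerSeries.coeff_succ_X_mul]
    simp only [this]
    conv_lhs => rw [key]
    simp only
    rw [e z hz, mul_add, Finset.mul_sum]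
    have : ∀ m, PowerSeries.coeff m (taylorPS (dslope h 0)) * z ^ (m+1) =
      z * (PowerSeries.coeff m (taylorPS (dslope h 0)) * z ^ m) := fun m => by ring
    simp only [this]
    ring

lemma taylorPS_of_hasSum {F : ℂ → ℂ} {a : ℕ → ℂ} {ρ : ℝ} (hρ : 0 < ρ)
    (hF : ∀ w ∈ ball (0 : ℂ) ρ, HasSum (fun m : ℕ => a m * w ^ m) (F w)) :
    AnalyticAt ℂ F 0 ∧ taylorPS F = PowerSeries.mk a := by
  have h1 : HasFPowerSeriesAt F (FormalMultilinearSeries.ofScalars ℂ a) 0 := by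
    rw [hasFPowerSeriesAt_iff]
    filter_upwards [ball_mem_nhds (0:ℂ) hρ] with z hz
    simpa [FormalMultilinearSeries.coeff_ofScalars, mul_comm] using hF z hz
  refine ⟨h1.analyticAt, ?_⟩
  have h2 := h1.analyticAt.hasFPowerSeriesAt
  have h3 := h1.eq_formalMultilinearSeries h2
  have h4 := FormalMultilinearSeries.ofScalars_series_injective ℂ ℂ h3
  rw [h4]; rfl

lemma parseval_one {r : ℝ} (hr : 0 < r) (hr1 : r < 1) (c : ℂ) {R : ℂ → ℂ}
    (hR : DifferentiableOn ℂ R (ball 0 1)) :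
    Real.circleAverage (fun z => ‖c + z * R z‖ ^ 2) 0 r =
      ‖c‖ ^ 2 + r ^ 2 * Real.circleAverage (fun z => ‖R z‖ ^ 2) 0 r := by
  have hsub : closedBall (0:ℂ) |r| ⊆ ball 0 1 := by
    rw [abs_of_pos hr]; exact closedBall_subset_ball hr1
  have hs : sphere (0:ℂ) |r| ⊆ ball 0 1 := sphere_subset_closedBall.trans hsub
  have hRc : ContinuousOn R (sphere (0:ℂ) |r|) := hR.continuousOn.mono hs
  have hd : DifferentiableOn ℂ (fun z => (starRingEnd ℂ c) * (z * R z)) (ball 0 1) := by fun_prop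
  have hm : Real.circleAverage (fun z => (starRingEnd ℂ c) * (z * R z)) 0 r = 0 := by
    have := circleAverage_of_differentiable_on_off_countable (s := ∅) (c := 0) (R := r)
      (f := fun z => (starRingEnd ℂ c) * (z * R z)) Set.countable_empty
      (hd.continuousOn.mono hsub) (fun z hz => hd.differentiableAt
        (isOpen_ball.mem_nhds (hsub (ball_subset_closedBall hz.1))))
    simpa using this
  have i1 : CircleIntegrable (fun z => (starRingEnd ℂ c) * (z * R z)) 0 r :=
    ContinuousOn.circleIntegrable' (by fun_prop)
  have hre : Real.circleAverage (fun z => ((starRingEnd ℂ c) * (z * R z)).re) 0 r = 0 := by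
    have := Complex.reCLM.circleAverage_comp_comm i1
    rw [hm] at this
    simpa [Function.comp_def] using this
  have i2 : CircleIntegrable (fun z => ‖R z‖^2) 0 r :=
    ContinuousOn.circleIntegrable' (by fun_prop)
  have i3 : CircleIntegrable (fun z => ((starRingEnd ℂ c) * (z * R z)).re) 0 r :=
    ContinuousOn.circleIntegrable' (by
      exact Complex.continuous_re.comp_continuousOn (by fun_prop))
  have e : Set.EqOn (fun z => ‖c + z * R z‖ ^ 2) (fun z => ‖c‖^2 + (r^2 • ‖R z‖^2 +
      (2:ℝ) • ((starRingEnd ℂ c) * (z * R z)).re)) (sphere 0 |r|) := by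
    intro z hz
    have hz' : ‖z‖ = r := by simpa [abs_of_pos hr] using hz
    simp only [smul_eq_mul]
    rw [← hz', ← mul_pow, ← norm_mul]
    simp only [← Complex.normSq_eq_norm_sq, Complex.normSq_apply]
    simp
    ring
  have j2 : CircleIntegrable (fun z => r^2 • ‖R z‖^2) 0 r :=
    ContinuousOn.circleIntegrable' (by fun_prop)
  have j3 : CircleIntegrable (fun z => (2:ℝ) • ((starRingEnd ℂ c) * (z * R z)).re) 0 r :=
    ContinuousOn.circleIntegrable' (ContinuousOn.const_smul
      (Complex.continuous_re.comp_continuousOn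
        (f := fun z => (starRingEnd ℂ c) * (z * R z)) (by fun_prop)) (2:ℝ))
  rw [Real.circleAverage_congr_sphere e,
    Real.circleAverage_fun_add (circleIntegrable_const _ _ _) (j2.fun_add j3),
    Real.circleAverage_fun_add j2 j3, Real.circleAverage_fun_smul, Real.circleAverage_fun_smul, hre,
    Real.circleAverage_const]
  simp

lemma parseval {r : ℝ} (hr : 0 < r) (hr1 : r < 1) (a : ℕ → ℂ) (p : ℕ) : ∀ {R : ℂ → ℂ},
    DifferentiableOn ℂ R (ball 0 1) →
    Real.circleAverage (fun z => ‖∑ m ∈ Finset.range p, a m * z ^ m + z ^ p * R z‖ ^ 2) 0 r =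
      ∑ m ∈ Finset.range p, ‖a m‖ ^ 2 * r ^ (2 * m)
        + r ^ (2 * p) * Real.circleAverage (fun z => ‖R z‖ ^ 2) 0 r := by
  induction p with
  | zero => intro R hR; simp
  | succ p ih =>
    intro R hR
    have := ih (R := fun z => a p + z * R z) (by fun_prop)
    rw [parseval_one hr hr1 _ hR] at this
    rw [Finset.sum_range_succ]
    have e : (fun z : ℂ => ‖∑ m ∈ Finset.range (p+1), a m * z ^ m + z ^ (p+1) * R z‖ ^ 2) =
      (fun z : ℂ => ‖∑ m ∈ Finset.range p, a m * z ^ m + z ^ p * (a p + z * R z)‖ ^ 2) := by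
      funext z; rw [Finset.sum_range_succ]; congr 2; ring
    rw [e, this]; ring

lemma clunie {ω : ℂ → ℂ} (hω : DifferentiableOn ℂ ω (ball 0 1))
    (hb : ∀ z ∈ ball (0 : ℂ) 1, ‖ω z‖ ≤ 1) (D : PowerSeries ℂ) (p : ℕ) :
    ∑ m ∈ Finset.range p, ‖PowerSeries.coeff m (taylorPS ω * D)‖ ^ 2 ≤
      ∑ m ∈ Finset.range p, ‖PowerSeries.coeff m D‖ ^ 2 := by
  set q : ℂ → ℂ := fun z => ∑ m ∈ Finset.range p, PowerSeries.coeff m D * z ^ m with hq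
  have hqd : Differentiable ℂ q := by
    rw [hq]; fun_prop
  have h0 : ball (0:ℂ) 1 ∈ nhds (0:ℂ) := ball_mem_nhds _ one_pos
  have hqT : taylorPS q = ∑ m ∈ Finset.range p, PowerSeries.C (PowerSeries.coeff m D) * PowerSeries.X ^ m := by
    rw [hq, taylorPS_sum (fun i => by fun_prop)]
    refine Finset.sum_congr rfl fun i _ => ?_
    rw [taylorPS_mul analyticAt_const (by fun_prop), taylorPS_const,
      taylorPS_pow (g := fun z => z) (by fun_prop), taylorPS_id]
  have hqc : ∀ m < p, PowerSeries.coeff m (taylorPS q) = PowerSeries.coeff m D := by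
    intro m hm
    rw [hqT, map_sum]
    simp [PowerSeries.coeff_X_pow, hm]
  set h : ℂ → ℂ := fun z => ω z * q z with hh
  have hhd : DifferentiableOn ℂ h (ball 0 1) := hω.mul hqd.differentiableOn
  have hhT : taylorPS h = taylorPS ω * taylorPS q :=
    taylorPS_mul (hω.analyticAt h0) (hqd.analyticAt 0)
  obtain ⟨R, hR, e⟩ := exists_decomp one_pos p hhd
  have hcoef : ∀ m < p, PowerSeries.coeff m (taylorPS h) = PowerSeries.coeff m (taylorPS ω * D) := by
    intro m hm
    rw [hhT, PowerSeries.coeff_mul, PowerSeries.coeff_mul]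
    refine Finset.sum_congr rfl fun i hi => ?_
    have : i.1 + i.2 = m := by simpa using hi
    rw [hqc _ (by omega)]
  have main : ∀ r : ℝ, 0 < r → r < 1 →
      ∑ m ∈ Finset.range p, ‖PowerSeries.coeff m (taylorPS ω * D)‖ ^ 2 * r ^ (2 * m) ≤
      ∑ m ∈ Finset.range p, ‖PowerSeries.coeff m D‖ ^ 2 * r ^ (2 * m) := by
    intro r hr hr1
    have hs : sphere (0:ℂ) |r| ⊆ ball 0 1 := by
      rw [abs_of_pos hr]; exact sphere_subset_closedBall.trans (closedBall_subset_ball hr1)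
    have P1 := parseval hr hr1 (fun m => PowerSeries.coeff m (taylorPS h)) p hR
    have P2 := parseval hr hr1 (fun m => PowerSeries.coeff m D) p (R := fun _ => 0) (by fun_prop)
    have c1 : Real.circleAverage (fun z => ‖h z‖ ^ 2) 0 r ≤ Real.circleAverage (fun z => ‖q z‖^2) 0 r := by
      apply Real.circleAverage_mono
      · exact ContinuousOn.circleIntegrable' ((hhd.continuousOn.mono hs).norm.pow 2)
      · exact ContinuousOn.circleIntegrable' (hqd.continuous.continuousOn.norm.pow 2)
      · intro z hz
        have := hb z (hs hz)
        simp only [hh, norm_mul]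
        gcongr
        exact mul_le_of_le_one_left (norm_nonneg _) this
    have c2 : Real.circleAverage (fun z => ‖h z‖ ^ 2) 0 r = Real.circleAverage
      (fun z => ‖∑ m ∈ Finset.range p, PowerSeries.coeff m (taylorPS h) * z ^ m + z ^ p * R z‖ ^ 2) 0 r := by
      apply Real.circleAverage_congr_sphere
      intro z hz
      simp only
      rw [← e z (hs hz)]
    rw [c2, P1] at c1
    have c3 : 0 ≤ Real.circleAverage (fun z => ‖R z‖ ^ 2) 0 r :=
      Real.circleAverage_nonneg_of_nonneg (fun z _ => by positivity)
    simp [Real.circleAverage_const] at P2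
    rw [show (fun z => ‖q z‖^2) = _ from rfl, P2] at c1
    have c4 : ∑ m ∈ Finset.range p, ‖PowerSeries.coeff m (taylorPS ω * D)‖ ^ 2 * r ^ (2 * m) =
        ∑ m ∈ Finset.range p, ‖PowerSeries.coeff m (taylorPS h)‖ ^ 2 * r ^ (2 * m) :=
      Finset.sum_congr rfl fun m hm => by rw [hcoef m (by simpa using hm)]
    have : 0 ≤ r ^ (2*p) * Real.circleAverage (fun z => ‖R z‖ ^ 2) 0 r := by positivity
    linarith
  have lim : ∀ b : ℕ → ℝ, Filter.Tendsto (fun r : ℝ => ∑ m ∈ Finset.range p, b m * r ^ (2 * m))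
      (nhdsWithin 1 (Set.Iio 1)) (nhds (∑ m ∈ Finset.range p, b m)) := by
    intro b
    have : Continuous (fun r : ℝ => ∑ m ∈ Finset.range p, b m * r ^ (2 * m)) := by fun_prop
    have := (this.tendsto 1).mono_left (nhdsWithin_le_nhds (s := Set.Iio 1))
    simpa using this
  refine le_of_tendsto_of_tendsto (lim _) (lim _) ?_
  filter_upwards [Ioo_mem_nhdsLT (zero_lt_one' ℝ)] with r hr
  exact main r hr.1 hr.2
open PowerSeries in
lemma derivative_inv_pow {u v : PowerSeries ℂ} (huv : u * v = 1) (l : ℕ) :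
    derivative ℂ (v ^ l) = - (l : PowerSeries ℂ) * v ^ (l+1) * derivative ℂ u := by
  have h1 : u * derivative ℂ v = - v * derivative ℂ u := by
    have := congrArg (derivative ℂ) huv
    rw [Derivation.leibniz, Derivation.map_one_eq_zero] at this
    simp only [smul_eq_mul] at this
    linear_combination this
  have h2 : derivative ℂ v = - v ^ 2 * derivative ℂ u := by
    linear_combination v * h1 - derivative ℂ v * huv
  rw [Derivation.leibniz_pow, h2]
  rcases l with _ | l
  · simp
  · simp only [nsmul_eq_mul, smul_eq_mul, Nat.add_sub_cancel]
    ring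

open PowerSeries in
lemma residue_aux {u v : PowerSeries ℂ} (huv : u * v = 1) (hv : coeff 0 v = 1) (hu : coeff 0 u = 1) (l : ℕ) :
    coeff l (v ^ (l+1) * (u + X * derivative ℂ u)) = if l = 0 then 1 else 0 := by
  rcases l with _ | l
  · simp at hu hv
    simp [hv, hu]
  · simp only [Nat.add_eq_zero_iff, one_ne_zero, and_false, if_false]
    have h := derivative_inv_pow huv (l+1)
    have h1 : ((l+1 : ℕ) : PowerSeries ℂ) * (v ^ (l+1+1) * (u + X * derivative ℂ u)) =
      ((l+1 : ℕ) : PowerSeries ℂ) * v ^ (l+1) - X * derivative ℂ (v ^ (l+1)) := by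
      rw [h]
      linear_combination ((l+1 : ℕ) : PowerSeries ℂ) * v ^ (l+1) * huv
    have h2 := congrArg (coeff (l+1)) h1
    have hc : ((l+1 : ℕ) : PowerSeries ℂ) = C ((l+1 : ℕ) : ℂ) := by simp
    rw [hc, map_sub, coeff_C_mul, coeff_C_mul, coeff_succ_X_mul, coeff_derivative] at h2
    have h3 : ((l+1 : ℕ) : ℂ) ≠ 0 := by exact_mod_cast l.succ_ne_zero
    have h4 : ((l+1 : ℕ) : ℂ) * coeff (l+1) (v ^ (l+1+1) * (u + X * derivative ℂ u)) = 0 := by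
      rw [h2]; push_cast; ring
    exact (mul_eq_zero.1 h4).resolve_left h3

open PowerSeries in
lemma lagrange_formal {u v R : PowerSeries ℂ} (huv : u * v = 1) (hv : coeff 0 v = 1)
    (hu : coeff 0 u = 1) (a : ℕ → ℂ) (n : ℕ)
    (h : X = ∑ m ∈ Finset.range (n+2), C (a m) * (X * u) ^ m + (X * u) ^ (n+2) * R) :
    ((n:ℂ)+1) * a (n+1) = coeff n (v ^ (n+1)) := by
  have hD : derivative ℂ (X * u) = u + X * derivative ℂ u := by
    rw [Derivation.leibniz, derivative_X]; simp only [smul_eq_mul]; ring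
  have h1 := congrArg (derivative ℂ) h
  rw [derivative_X, map_add, map_sum, Finset.sum_range_succ'] at h1
  have h0 : derivative ℂ (C (a 0) * (X * u) ^ 0) = 0 := by simp
  rw [h0, add_zero] at h1
  have ht : ∀ m, derivative ℂ (C (a (m+1)) * (X * u) ^ (m+1)) =
      C (((m:ℂ)+1) * a (m+1)) * (X * u) ^ m * (u + X * derivative ℂ u) := by
    intro m
    rw [Derivation.leibniz, Derivation.leibniz_pow, hD, derivative_C]
    simp only [smul_eq_mul, nsmul_eq_mul, Nat.add_sub_cancel, map_mul, map_add, map_natCast, map_one]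
    push_cast
    ring
  simp only [ht] at h1
  have hl : derivative ℂ ((X * u) ^ (n+2) * R) = X ^ (n+1) *
      (u ^ (n+1) * ((X * u) * derivative ℂ R + R * (((n+2 : ℕ) : PowerSeries ℂ) * (u + X * derivative ℂ u)))) := by
    rw [Derivation.leibniz, Derivation.leibniz_pow, hD]
    simp only [smul_eq_mul, nsmul_eq_mul]
    have : n + 2 - 1 = n + 1 := rfl
    rw [this]
    ring
  rw [hl] at h1
  have h2 := congrArg (fun P => coeff n (v ^ (n+1) * P)) h1
  simp only [mul_one, mul_add (v ^ (n+1)), map_add, Finset.mul_sum, map_sum] at h2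
  rw [h2]
  have z : ∀ P, coeff n (v ^ (n+1) * (X ^ (n+1) * P)) = 0 := by
    intro P
    rw [mul_left_comm, coeff_X_pow_mul']
    simp
  have hu' : ∀ m ≤ n, u ^ m * v ^ (n+1) = v ^ (n - m + 1) := by
    intro m hm
    have : n + 1 = m + (n - m + 1) := by omega
    rw [this, pow_add, ← mul_assoc, ← mul_pow, huv, one_pow, one_mul]
  have t : ∀ m ∈ Finset.range (n+1), coeff n (v ^ (n+1) * (C (((m:ℂ)+1) * a (m+1)) * (X * u) ^ m * (u + X * derivative ℂ u)))
      = if m = n then ((n:ℂ)+1) * a (n+1) else 0 := by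
    intro m hm
    have hm' : m ≤ n := by simpa [Nat.lt_succ_iff] using hm
    have : v ^ (n+1) * (C (((m:ℂ)+1) * a (m+1)) * (X * u) ^ m * (u + X * derivative ℂ u)) =
      C (((m:ℂ)+1) * a (m+1)) * (X ^ m * (v ^ (n - m + 1) * (u + X * derivative ℂ u))) := by
      rw [← hu' m hm']; ring
    rw [this, coeff_C_mul, coeff_X_pow_mul', if_pos hm', residue_aux huv hv hu]
    by_cases e : m = n
    · simp [e]
    · rw [if_neg e, if_neg (by omega), mul_zero]
  rw [Finset.sum_congr rfl t]
  simp [z]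

open PowerSeries in
lemma ode_formal {u v W : PowerSeries ℂ} (huv : u * v = 1) (A B : ℂ) (n : ℕ)
    (h : X * derivative ℂ (X * u) * (1 + C B * X * W) = X * u * (1 + C A * X * W)) (m : ℕ) :
    ((m:ℂ)+1) * coeff (m+1) (v ^ n) =
      - coeff m (W * PowerSeries.mk fun j => (n * (A - B) + B * j) * coeff j (v ^ n)) := by
  have hD : derivative ℂ (X * u) = u + X * derivative ℂ u := by
    rw [Derivation.leibniz, derivative_X]; simp only [smul_eq_mul]; ring
  have hm : (PowerSeries.mk fun j => (n * (A - B) + B * j) * coeff j (v ^ n)) =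
      C (n * (A - B)) * v ^ n + C B * (X * derivative ℂ (v ^ n)) := by
    ext j
    rw [map_add, coeff_C_mul, coeff_C_mul, coeff_mk]
    rcases j with _ | j
    · simp
    · rw [coeff_succ_X_mul, coeff_derivative]; push_cast; ring
  rw [hm]
  have hX : (X * X : PowerSeries ℂ) ≠ 0 := mul_ne_zero X_ne_zero X_ne_zero
  rw [hD] at h
  have key : derivative ℂ (v ^ n) = - (W * (C (n * (A - B)) * v ^ n + C B * (X * derivative ℂ (v ^ n)))) := by
    apply mul_left_cancel₀ hX
    rw [derivative_inv_pow huv]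
    simp only [map_mul, map_sub, map_natCast]
    linear_combination (-(n : PowerSeries ℂ) * v ^ (n+1)) * h
      + (- (n : PowerSeries ℂ)) * v ^ n * (C A - C B) * X * X * W * huv
  have := congrArg (coeff m) key
  rw [coeff_derivative, map_neg] at this
  rw [← this]; ring

lemma numeric (x : ℕ → ℝ) (hx : ∀ m, 0 ≤ x m) (hx0 : x 0 = 1) (B c : ℝ) (hB : -1 ≤ B) (hc : 0 ≤ c)
    (H : ∀ p, ∑ m ∈ Finset.range p, ((m:ℝ)+1)^2 * x (m+1) ^ 2 ≤ ∑ m ∈ Finset.range p, (c + B * m)^2 * x m ^ 2)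
    (M N : ℕ) (hMN : M ≤ N)
    (h1 : ∀ m : ℕ, m < M → (1 - B) * m ≤ c) (h2 : ∀ m : ℕ, M ≤ m → c ≤ (1 - B) * m) :
    N * x N ≤ M * ∏ j ∈ Finset.range M, (c + B * j) / ((j:ℝ) + 1) := by
  set P : ℕ → ℝ := fun p => ∏ j ∈ Finset.range p, (c + B * j) / ((j:ℝ) + 1) with hP
  set e : ℕ → ℝ := fun m => (c + B * m)^2 - (m:ℝ)^2 with he
  have e_fac : ∀ m, e m = (c - (1 - B) * m) * (c + (1 + B) * m) := by intro m; simp only [he]; ring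
  have e2 : ∀ m : ℕ, 0 ≤ c + (1 + B) * m := by
    intro m
    have : 0 ≤ (1 + B) * (m:ℝ) := mul_nonneg (by linarith) (by positivity)
    linarith
  have H' : ∀ p : ℕ, (p:ℝ)^2 * x p ^ 2 ≤ ∑ m ∈ Finset.range p, e m * x m ^ 2 := by
    intro p
    have s1 := Finset.sum_range_succ (fun m : ℕ => (m:ℝ)^2 * x m ^ 2) p
    have s2 := Finset.sum_range_succ' (fun m : ℕ => (m:ℝ)^2 * x m ^ 2) p
    have := H p
    simp only [he, sub_mul, Finset.sum_sub_distrib]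
    push_cast at s2
    simp at s2
    linarith
  have PS : ∀ p : ℕ, ∑ m ∈ Finset.range p, e m * P m ^ 2 = (p:ℝ)^2 * P p ^ 2 := by
    intro p
    induction p with
    | zero => simp
    | succ p ih =>
      rw [Finset.sum_range_succ, ih]
      have : P (p+1) = P p * ((c + B * p) / ((p:ℝ)+1)) := by simp only [hP]; rw [Finset.prod_range_succ]
      rw [this]
      have : (p:ℝ)+1 ≠ 0 := by positivity
      simp only [he]; push_cast
      field_simp
      ring
  have Pn : ∀ p ≤ M, 0 ≤ P p := by
    intro p hp
    apply Finset.prod_nonneg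
    intro j hj
    have hj' : j < p := by simpa using hj
    have := h1 j (by omega)
    have hj0 : (0:ℝ) ≤ j := by positivity
    apply div_nonneg _ (by positivity)
    nlinarith
  have bd : ∀ p ≤ M, x p ≤ P p := by
    intro p
    induction p using Nat.strong_induction_on with
    | _ p ih =>
      intro hp
      rcases Nat.eq_zero_or_pos p with rfl | hpos
      · simp [hP, hx0]
      · have a1 := H' p
        have a2 : ∑ m ∈ Finset.range p, e m * x m ^ 2 ≤ ∑ m ∈ Finset.range p, e m * P m ^ 2 := by
          apply Finset.sum_le_sum
          intro m hm
          have hm' : m < p := by simpa using hm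
          have := ih m hm' (by omega)
          have e0 : 0 ≤ e m := by
            rw [e_fac]; exact mul_nonneg (by linarith [h1 m (by omega)]) (e2 m)
          have := hx m
          gcongr
        rw [PS] at a2
        have hp0 : (0:ℝ) < (p:ℝ)^2 := by positivity
        have : x p ^ 2 ≤ P p ^ 2 := le_of_mul_le_mul_left (a1.trans a2) hp0
        exact le_of_sq_le_sq this (Pn p hp)
  have a1 := H' N
  have a2 : ∑ m ∈ Finset.range N, e m * x m ^ 2 ≤ ∑ m ∈ Finset.range M, e m * P m ^ 2 := by
    rw [← Finset.sum_range_add_sum_Ico _ hMN]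
    have b1 : ∑ m ∈ Finset.range M, e m * x m ^ 2 ≤ ∑ m ∈ Finset.range M, e m * P m ^ 2 := by
      apply Finset.sum_le_sum
      intro m hm
      have hm' : m < M := by simpa using hm
      have := bd m hm'.le
      have e0 : 0 ≤ e m := by
        rw [e_fac]; exact mul_nonneg (by linarith [h1 m (by omega)]) (e2 m)
      have := hx m
      gcongr
    have b2 : ∑ m ∈ Finset.Ico M N, e m * x m ^ 2 ≤ 0 := by
      apply Finset.sum_nonpos
      intro m hm
      have hm' : M ≤ m := (Finset.mem_Ico.1 hm).1
      have e0 : e m ≤ 0 := by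
        rw [e_fac]; exact mul_nonpos_of_nonpos_of_nonneg (by linarith [h2 m hm']) (e2 m)
      exact mul_nonpos_of_nonpos_of_nonneg e0 (sq_nonneg _)
    linarith
  rw [PS] at a2
  have : (N * x N) ^ 2 ≤ (M * P M) ^ 2 := by rw [mul_pow, mul_pow]; exact a1.trans a2
  exact le_of_sq_le_sq this (mul_nonneg (by positivity) (Pn M le_rfl))


theorem inverse_coeff_bound_case_ii (A B δ : ℝ) (hB : -1 ≤ B) (hBA : B < A) (hA : A ≤ 1)
    (hδ : δ = (1 - A) / (1 - B))
    (f F : ℂ → ℂ) (hf : IsJanowskiStarlike A B f)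
    (Acoef : ℕ → ℂ) (hA0 : Acoef 0 = 0) (hA1 : Acoef 1 = 1)
    (ρ : ℝ) (hρ : 0 < ρ)
    (hF : ∀ w ∈ ball (0 : ℂ) ρ,
      F w ∈ ball (0 : ℂ) 1 ∧ f (F w) = w ∧
        HasSum (fun m : ℕ => Acoef m * w ^ m) (F w))
    (n k : ℕ) (hn : 2 ≤ n) (hk2 : 2 ≤ k) (hkn : k ≤ n - 2)
    (hδ1 : (k : ℝ) / n ≤ δ) (hδ2 : δ < ((k : ℝ) + 1) / n) :
    ‖Acoef n‖ ≤ ((n : ℝ) - k) / (n * (n - 1)) *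
      ∏ j ∈ Finset.range (n - k), (n * (A - B) + B * j) / (j + 1) := by

  obtain ⟨hfa, hf0, hf1, ω, hωa, hωb, hode⟩ := hf
  have h0 : ball (0:ℂ) 1 ∈ nhds (0:ℂ) := ball_mem_nhds _ one_pos
  have hfd : DifferentiableOn ℂ f (ball 0 1) := hfa.differentiableOn
  have hωd : DifferentiableOn ℂ ω (ball 0 1) := hωa.differentiableOn
  have hfA : AnalyticAt ℂ f 0 := hfd.analyticAt h0
  have hωA : AnalyticAt ℂ ω 0 := hωd.analyticAt h0
  have hid : AnalyticAt ℂ (fun z : ℂ => z) 0 := by fun_prop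
  obtain ⟨hFA, hFT⟩ := taylorPS_of_hasSum hρ (fun w hw => (hF w hw).2.2)
  have hF0 : F 0 = 0 := by
    rw [← taylorPS_coeff_zero F, hFT]; simpa using hA0
  set u : PowerSeries ℂ := PowerSeries.mk fun m => PowerSeries.coeff (m+1) (taylorPS f) with hu
  have hfu : taylorPS f = PowerSeries.X * u := by
    ext m
    rcases m with _ | m
    · rw [taylorPS_coeff_zero, hf0]; simp
    · rw [PowerSeries.coeff_succ_X_mul, hu, PowerSeries.coeff_mk]
  have hu0 : PowerSeries.coeff 0 u = 1 := by
    simp [hu, taylorPS, hf1]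
  have hu0' : PowerSeries.constantCoeff u = 1 := by simpa using hu0
  set v : PowerSeries ℂ := u⁻¹ with hv
  have huv : u * v = 1 := PowerSeries.mul_inv_cancel u (by rw [hu0']; exact one_ne_zero)
  have hv0 : PowerSeries.coeff 0 v = 1 := by
    simp [hv, hu0']
  have hinj : ∀ᶠ z in nhds (0:ℂ), F (f z) = z := by
    have hs : HasStrictDerivAt f 1 0 := by
      have := hfA.hasStrictDerivAt
      rwa [hf1] at this
    have hl := hs.eventually_left_inverse one_ne_zero
    have hfc : Filter.Tendsto f (nhds 0) (nhds 0) := by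
      have := hfA.continuousAt.tendsto
      rwa [hf0] at this
    have hFc : Filter.Tendsto F (nhds 0) (nhds 0) := by
      have := hFA.continuousAt.tendsto
      rwa [hF0] at this
    have hl2 := (hFc.comp hfc).eventually hl
    filter_upwards [hl, hl2, hfc.eventually (ball_mem_nhds (0:ℂ) hρ)] with z z1 z2 z3
    have e := (hF _ z3).2.1
    simp only [Function.comp_apply] at z2
    rw [e] at z2
    rw [← z2, z1]
  obtain ⟨N, rfl⟩ : ∃ N, n = N + 1 := ⟨n - 1, by omega⟩
  obtain ⟨ε, hε, hFε⟩ : ∃ ε > 0, DifferentiableOn ℂ F (ball 0 ε) := by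
    obtain ⟨ε, hε, h⟩ := Metric.eventually_nhds_iff_ball.1 hFA.eventually_analyticAt
    exact ⟨ε, hε, fun z hz => (h z hz).differentiableAt.differentiableWithinAt⟩
  obtain ⟨R, hR, hdec⟩ := exists_decomp hε (N+2) hFε
  have hRA : AnalyticAt ℂ (fun z => R (f z)) 0 := by
    have : AnalyticAt ℂ R (f 0) := by rw [hf0]; exact hR.analyticAt (ball_mem_nhds _ hε)
    exact this.fun_comp hfA
  have hX : (fun z : ℂ => z) =ᶠ[nhds 0] fun z =>
      ∑ m ∈ Finset.range (N+2), Acoef m * f z ^ m + f z ^ (N+2) * R (f z) := by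
    have hfc : Filter.Tendsto f (nhds 0) (nhds 0) := by
      have := hfA.continuousAt.tendsto
      rwa [hf0] at this
    filter_upwards [hinj, hfc.eventually (ball_mem_nhds (0:ℂ) hε)] with z z1 z2
    have := hdec _ z2
    rw [z1, hFT] at this
    simpa using this
  have hXT := taylorPS_congr hX
  rw [taylorPS_id, taylorPS_add (Finset.analyticAt_fun_sum _ fun i _ =>
      analyticAt_const.fun_mul (hfA.fun_pow i)) ((hfA.fun_pow _).fun_mul hRA),
    taylorPS_sum (fun i => analyticAt_const.fun_mul (hfA.fun_pow i)),
    taylorPS_mul (hfA.fun_pow _) hRA, taylorPS_pow hfA] at hXT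
  have hterm : ∀ i, taylorPS (fun z => Acoef i * f z ^ i) =
      PowerSeries.C (Acoef i) * (PowerSeries.X * u) ^ i := by
    intro i
    rw [taylorPS_mul analyticAt_const (hfA.fun_pow _), taylorPS_const, taylorPS_pow hfA, hfu]
  simp only [hterm] at hXT
  rw [hfu] at hXT
  have hlag := lagrange_formal huv hv0 hu0 Acoef N hXT
  have hodeT : PowerSeries.X * PowerSeries.derivative ℂ (PowerSeries.X * u) *
      (1 + PowerSeries.C (B:ℂ) * PowerSeries.X * taylorPS ω) =
      PowerSeries.X * u * (1 + PowerSeries.C (A:ℂ) * PowerSeries.X * taylorPS ω) := by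
    have e : (fun z => z * deriv f z * (1 + (B : ℂ) * z * ω z)) =ᶠ[nhds 0]
        fun z => f z * (1 + (A : ℂ) * z * ω z) := by
      filter_upwards [h0] with z hz using hode z hz
    have e2 := taylorPS_congr e
    have hc : ∀ c : ℂ, AnalyticAt ℂ (fun z => c * z) 0 := fun c => by fun_prop
    have hc2 : ∀ c : ℂ, AnalyticAt ℂ (fun z => c * z * ω z) 0 := fun c => (hc c).fun_mul hωA
    have hc3 : ∀ c : ℂ, AnalyticAt ℂ (fun z => 1 + c * z * ω z) 0 :=
      fun c => analyticAt_const.fun_add (hc2 c)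
    have hT : ∀ c : ℂ, taylorPS (fun z => 1 + c * z * ω z) =
        1 + PowerSeries.C c * PowerSeries.X * taylorPS ω := by
      intro c
      rw [taylorPS_add analyticAt_const (hc2 c), taylorPS_mul (hc c) hωA,
        taylorPS_mul analyticAt_const hid, taylorPS_const, taylorPS_const, taylorPS_id, map_one]
    rw [taylorPS_mul (hid.fun_mul hfA.deriv) (hc3 _), taylorPS_mul hid hfA.deriv,
      taylorPS_mul hfA (hc3 _), hT, hT, taylorPS_id, taylorPS_deriv, hfu] at e2
    exact e2
  have hrec := ode_formal huv (A:ℂ) (B:ℂ) (N+1) hodeT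
  set c : ℝ := ((N+1 : ℕ) : ℝ) * (A - B) with hc
  set x : ℕ → ℝ := fun m => ‖PowerSeries.coeff m (v ^ (N+1))‖ with hx
  have hN0 : (0:ℝ) < ((N+1 : ℕ) : ℝ) := by positivity
  have hc0 : 0 ≤ c := mul_nonneg hN0.le (by linarith)
  have H : ∀ p, ∑ m ∈ Finset.range p, ((m:ℝ)+1)^2 * x (m+1) ^ 2 ≤
      ∑ m ∈ Finset.range p, (c + B * m)^2 * x m ^ 2 := by
    intro p
    refine le_trans (le_of_eq ?_) ((clunie hωd hωb (PowerSeries.mk fun j =>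
      (((N+1 : ℕ) : ℂ) * ((A:ℂ) - B) + B * j) * PowerSeries.coeff j (v ^ (N+1))) p).trans
      (le_of_eq ?_))
    · refine Finset.sum_congr rfl fun m _ => ?_
      have := congrArg norm (hrec m)
      rw [norm_neg, norm_mul] at this
      rw [← this, mul_pow]
      congr 2
      rw [show (m:ℂ) + 1 = ((m + 1 : ℕ) : ℂ) by push_cast; ring, Complex.norm_natCast]
      push_cast; ring
    · refine Finset.sum_congr rfl fun m _ => ?_
      rw [PowerSeries.coeff_mk, norm_mul, mul_pow]
      congr 1
      rw [show ((N+1 : ℕ) : ℂ) * ((A:ℂ) - B) + B * m = ((c + B * m : ℝ) : ℂ) by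
        rw [hc]; push_cast; ring, Complex.norm_real, Real.norm_eq_abs, sq_abs]
  have hB1 : 0 < 1 - B := by linarith
  have hkc : ((N + 1 - k : ℕ) : ℝ) = ((N+1 : ℕ) : ℝ) - k := by
    rw [Nat.cast_sub (by omega)]
  have hcδ : c = ((N+1 : ℕ) : ℝ) * (1 - B) * (1 - δ) := by
    rw [hc, hδ]; field_simp; ring
  rw [div_le_iff₀ hN0] at hδ1
  rw [lt_div_iff₀ hN0] at hδ2
  have hnum := numeric x (fun m => norm_nonneg _) (by simp at hv0; simp [hx, hv0]) B c hB hc0 H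
    (N + 1 - k) N (by omega)
    (by
      intro m hm
      have : (m:ℝ) + 1 ≤ ((N+1 : ℕ) : ℝ) - k := by rw [← hkc]; exact_mod_cast hm
      rw [hcδ]
      nlinarith)
    (by
      intro m hm
      have : ((N+1 : ℕ) : ℝ) - k ≤ (m:ℝ) := by rw [← hkc]; exact_mod_cast hm
      rw [hcδ]
      nlinarith)
  have hxN : ((N+1 : ℕ) : ℝ) * ‖Acoef (N+1)‖ = x N := by
    have := congrArg norm hlag
    rw [norm_mul, show (N:ℂ) + 1 = ((N + 1 : ℕ) : ℂ) by push_cast; ring,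
      Complex.norm_natCast] at this
    exact this
  rw [← hxN, hkc] at hnum
  have hNpos : (0:ℝ) < N := by
    have : 0 < N := by omega
    exact_mod_cast this
  have hN1 : ((N+1 : ℕ) : ℝ) - 1 = N := by push_cast; ring
  rw [hN1, div_mul_eq_mul_div, le_div_iff₀ (mul_pos hN0 hNpos)]
  linarith
end

section
/- Let -1 ≤ B < 1, f ∈ S*(1,B), and F(w) = w + Σ_{n≥2} A_n wⁿ the inverse of f near the origin. Then for every n ≥ 2, |A_n| ≤ (1/n)·Π_{j=0}^{n-2} (n(1-B)+Bj)/(j+1), with equality for f = k_{1,B}. -/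
open Metric Complex

/-- The Janowski extremal function `k_{A,B}`. -/
noncomputable def janowskiKernel (A B : ℝ) : ℂ → ℂ := fun z =>
  if B = 0 then z * Complex.exp ((A : ℂ) * z)
  else z * (1 + (B : ℂ) * z) ^ ((A : ℂ) / (B : ℂ) - 1)

/-- `F`, with Taylor coefficients `Acoef`, is the inverse of `f` near the origin. -/
def IsLocalInverseWithCoeff (f F : ℂ → ℂ) (Acoef : ℕ → ℂ) : Prop :=
  Acoef 0 = 0 ∧ Acoef 1 = 1 ∧
    ∃ ρ : ℝ, 0 < ρ ∧ ∀ w ∈ ball (0 : ℂ) ρ,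
      F w ∈ ball (0 : ℂ) 1 ∧ f (F w) = w ∧
        HasSum (fun m : ℕ => Acoef m * w ^ m) (F w)


namespace JanowskiProof
open PowerSeries

lemma deriv_inv_rel {u g : PowerSeries ℂ} (hg : u * g = 1) :
    derivative ℂ g = - (g ^ 2 * derivative ℂ u) := by
  have h := congrArg (derivative ℂ) hg
  rw [Derivation.leibniz] at h
  simp only [smul_eq_mul, Derivation.map_one_eq_zero] at h
  linear_combination g * h - (derivative ℂ g) * hg

lemma coeff_term (u g f : PowerSeries ℂ) (hf : f = X * u) (hg : u * g = 1) (i k : ℕ) :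
    coeff (i + k) (f ^ i * derivative ℂ f * g ^ (i + k + 1)) = if k = 0 then 1 else 0 := by
  have hdf : derivative ℂ f = u + X * derivative ℂ u := by
    rw [hf, Derivation.leibniz]; simp [add_comm]
  have hu : u ^ i * g ^ i = 1 := by rw [← mul_pow, hg, one_pow]
  have h1 : f ^ i * derivative ℂ f * g ^ (i + k + 1) = X ^ i * (derivative ℂ f * g ^ (k + 1)) := by
    rw [hf, mul_pow, ← hf]
    rw [show i + k + 1 = i + (k + 1) by ring, pow_add]
    linear_combination (X ^ i * derivative ℂ f * g ^ (k + 1)) * hu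
  rw [h1, add_comm i k, coeff_X_pow_mul]
  have h2 : derivative ℂ f * g ^ (k + 1) = g ^ k + X * (g ^ (k + 1) * derivative ℂ u) := by
    rw [hdf, pow_succ]; linear_combination (g ^ k) * hg
  rw [h2]
  rcases k with _ | k
  · simp
  · rw [map_add, coeff_succ_X_mul]
    have h3 : derivative ℂ (g ^ (k + 1)) = -((k + 1 : ℕ) : PowerSeries ℂ) * (g ^ (k + 1 + 1) * derivative ℂ u) := by
      rw [derivative_pow, deriv_inv_rel hg]; simp only [Nat.add_sub_cancel]; ring
    have h4 := congrArg (coeff k) h3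
    rw [coeff_derivative, neg_mul, map_neg, ← map_natCast (C (R := ℂ)), coeff_C_mul] at h4
    have : ((k : ℂ) + 1) ≠ 0 := by exact_mod_cast Nat.succ_ne_zero k
    simp only [Nat.succ_ne_zero, if_false]
    push_cast at h4
    apply mul_left_cancel₀ this
    linear_combination h4

lemma formal_lagrange (f u g : PowerSeries ℂ) (hf : f = X * u) (hg : u * g = 1) (a : ℕ → ℂ) (n : ℕ)
    (hX : X ^ (n + 2) ∣ X - ∑ m ∈ Finset.range (n + 2), C (a m) * f ^ m) :
    ((n : ℂ) + 1) * a (n + 1) = coeff n (g ^ (n + 1)) := by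
  obtain ⟨R, hR⟩ := hX
  have h0 : (X : PowerSeries ℂ) = ∑ m ∈ Finset.range (n + 2), C (a m) * f ^ m + X ^ (n + 2) * R := by
    rw [← hR]; ring
  have h1 := congrArg (fun p => coeff n (derivative ℂ p * g ^ (n + 1))) h0
  simp only [map_add, map_sum, add_mul, Finset.sum_mul] at h1
  rw [derivative_X, one_mul, Finset.sum_range_succ'] at h1
  have hz : coeff n (derivative ℂ (X ^ (n + 2) * R) * g ^ (n + 1)) = 0 := by
    have : derivative ℂ (X ^ (n + 2) * R) * g ^ (n + 1)
        = X ^ (n + 1) * ((((n + 2 : ℕ) : PowerSeries ℂ) * R + X * derivative ℂ R) * g ^ (n + 1)) := by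
      rw [Derivation.leibniz, derivative_pow, derivative_X]
      simp only [smul_eq_mul, show n + 2 - 1 = n + 1 by omega]; ring
    rw [this]
    exact (X_pow_dvd_iff.1 ⟨_, rfl⟩) n (by omega)
  have ht : ∀ i ∈ Finset.range (n + 1), coeff n (derivative ℂ (C (a (i + 1)) * f ^ (i + 1)) * g ^ (n + 1))
      = if i = n then ((n : ℂ) + 1) * a (n + 1) else 0 := by
    intro i hi
    obtain ⟨k, rfl⟩ : ∃ k, n = i + k := ⟨n - i, by have := Finset.mem_range.1 hi; omega⟩
    have : derivative ℂ (C (a (i + 1)) * f ^ (i + 1)) * g ^ (i + k + 1)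
        = C (a (i + 1) * ((i + 1 : ℕ) : ℂ)) * (f ^ i * derivative ℂ f * g ^ (i + k + 1)) := by
      rw [Derivation.leibniz, derivative_pow, derivative_C, map_mul, map_natCast]
      simp only [smul_eq_mul, Nat.add_sub_cancel]; ring
    rw [this, coeff_C_mul, coeff_term u g f hf hg]
    rcases k with _ | k
    · simp; ring
    · simp
  rw [Finset.sum_congr rfl ht, hz] at h1
  simp at h1
  exact h1.symm

lemma formal_ode (f u g W : PowerSeries ℂ) (B : ℂ) (hf : f = X * u) (hg : u * g = 1)
    (h : X * derivative ℂ f * (1 + C B * X * W) = f * (1 + X * W)) (n : ℕ) :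
    X * derivative ℂ (g ^ (n + 1)) = - (X * (W *
      (C (((n : ℂ) + 1) * (1 - B)) * g ^ (n + 1) + C B * (X * derivative ℂ (g ^ (n + 1)))))) := by
  have hdf : derivative ℂ f = u + X * derivative ℂ u := by
    rw [hf, Derivation.leibniz]; simp [add_comm]
  rw [hdf, hf] at h
  have h2 : X * ((u + X * derivative ℂ u) * (1 + C B * X * W)) = X * (u * (1 + X * W)) := by
    linear_combination h
  replace h := mul_left_cancel₀ X_ne_zero h2
  have hC : (C (((n : ℂ) + 1) * (1 - B)) : PowerSeries ℂ) = ((n : PowerSeries ℂ) + 1) * (1 - C B) := by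
    simp
  rw [hC, derivative_pow, deriv_inv_rel hg]
  simp only [Nat.add_sub_cancel]
  push_cast
  have e : X * derivative ℂ u * (1 + C B * X * W) = u * X * W * (1 - C B) := by
    linear_combination h
  linear_combination (-(((n : PowerSeries ℂ) + 1) * g ^ n * g ^ 2)) * e
    - ((n : PowerSeries ℂ) + 1) * g ^ n * g * X * W * (1 - C B) * hg


/-- `p` is the power series of `f` at the origin. -/
def Rep (f : ℂ → ℂ) (p : PowerSeries ℂ) : Prop :=
  ∀ᶠ z in nhds (0 : ℂ), HasSum (fun k => coeff k p * z ^ k) (f z)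

lemma rep_iff {f : ℂ → ℂ} {p : PowerSeries ℂ} :
    Rep f p ↔ HasFPowerSeriesAt f (FormalMultilinearSeries.ofScalars ℂ (fun k => coeff k p)) 0 := by
  rw [hasFPowerSeriesAt_iff]
  simp only [FormalMultilinearSeries.coeff_ofScalars, zero_add, smul_eq_mul, Rep, mul_comm]

lemma Rep.analyticAt {f : ℂ → ℂ} {p : PowerSeries ℂ} (h : Rep f p) : AnalyticAt ℂ f 0 :=
  (rep_iff.1 h).analyticAt

lemma Rep.unique {f : ℂ → ℂ} {p q : PowerSeries ℂ} (h : Rep f p) (h' : Rep f q) : p = q := by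
  have := (rep_iff.1 h).eq_formalMultilinearSeries (rep_iff.1 h')
  ext k
  simpa using congrArg (fun s => FormalMultilinearSeries.coeff s k) this

lemma Rep.congr {f g : ℂ → ℂ} {p : PowerSeries ℂ} (h : Rep f p) (hfg : f =ᶠ[nhds 0] g) : Rep g p := by
  filter_upwards [h, hfg] with z hz hz'
  rwa [← hz']

/-- Taylor series at the origin. -/
noncomputable def T (f : ℂ → ℂ) : PowerSeries ℂ := mk fun k => iteratedDeriv k f 0 / k.factorial

lemma rep_T {f : ℂ → ℂ} (h : AnalyticAt ℂ f 0) : Rep f (T f) := by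
  rw [rep_iff]
  simpa [T] using h.hasFPowerSeriesAt

lemma T_deriv (f : ℂ → ℂ) : T (deriv f) = derivative ℂ (T f) := by
  ext k
  have : ((k : ℂ) + 1) ≠ 0 := by exact_mod_cast Nat.succ_ne_zero k
  have h2 : (k.factorial : ℂ) ≠ 0 := by exact_mod_cast k.factorial_ne_zero
  rw [coeff_derivative, T, T, coeff_mk, coeff_mk, iteratedDeriv_succ', Nat.factorial_succ]
  push_cast
  field_simp

lemma Rep.deriv {f : ℂ → ℂ} {p : PowerSeries ℂ} (h : Rep f p) : Rep (deriv f) (derivative ℂ p) := by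
  have := h.unique (rep_T h.analyticAt)
  rw [this, ← T_deriv]
  exact rep_T h.analyticAt.deriv

lemma hasSum_mul {p q : PowerSeries ℂ} {z a b : ℂ} (hp : HasSum (fun k => coeff k p * z ^ k) a)
    (hq : HasSum (fun k => coeff k q * z ^ k) b) : HasSum (fun k => coeff k (p * q) * z ^ k) (a * b) := by
  have h1 := hp.summable.norm
  have h2 := hq.summable.norm
  have h3 := (summable_norm_sum_mul_antidiagonal_of_summable_norm h1 h2).of_norm.hasSum
  rw [← tsum_mul_tsum_eq_tsum_sum_antidiagonal_of_summable_norm h1 h2, hp.tsum_eq, hq.tsum_eq] at h3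
  suffices e : (fun k => coeff k (p * q) * z ^ k) = fun n => ∑ kl ∈ Finset.HasAntidiagonal.antidiagonal n,
      coeff kl.1 p * z ^ kl.1 * (coeff kl.2 q * z ^ kl.2) by
    rw [e]; exact h3
  funext k
  rw [coeff_mul, Finset.sum_mul]
  refine Finset.sum_congr rfl fun x hx => ?_
  rw [← Finset.HasAntidiagonal.mem_antidiagonal.1 hx, pow_add]; ring

lemma Rep.mul {f g : ℂ → ℂ} {p q : PowerSeries ℂ} (hf : Rep f p) (hg : Rep g q) :
    Rep (fun z => f z * g z) (p * q) := by
  filter_upwards [hf, hg] with z h1 h2 using hasSum_mul h1 h2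

lemma Rep.add {f g : ℂ → ℂ} {p q : PowerSeries ℂ} (hf : Rep f p) (hg : Rep g q) :
    Rep (fun z => f z + g z) (p + q) := by
  filter_upwards [hf, hg] with z h1 h2
  simpa [add_mul] using h1.add h2

lemma hasSum_C (c z : ℂ) : HasSum (fun k => coeff k (C c : PowerSeries ℂ) * z ^ k) c := by
  convert hasSum_single 0 ?_ using 1
  · simp
  · intro k hk; simp [coeff_C, hk]

lemma hasSum_X (z : ℂ) : HasSum (fun k => coeff k (X : PowerSeries ℂ) * z ^ k) z := by
  convert hasSum_single 1 ?_ using 1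
  · simp
  · intro k hk; simp [coeff_X, hk]

lemma rep_C (c : ℂ) : Rep (fun _ => c) (C c) := Filter.Eventually.of_forall fun z => hasSum_C c z

lemma rep_X : Rep (fun z => z) X := Filter.Eventually.of_forall fun z => hasSum_X z

lemma Rep.pow {f : ℂ → ℂ} {p : PowerSeries ℂ} (hf : Rep f p) (n : ℕ) :
    Rep (fun z => f z ^ n) (p ^ n) := by
  induction n with
  | zero => simpa using rep_C 1
  | succ n ih => simpa [pow_succ] using ih.mul hf

lemma rep_sum {f : ℕ → ℂ → ℂ} {p : ℕ → PowerSeries ℂ} (h : ∀ k, Rep (f k) (p k)) (n : ℕ) :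
    Rep (fun z => ∑ k ∈ Finset.range n, f k z) (∑ k ∈ Finset.range n, p k) := by
  induction n with
  | zero => simpa using rep_C 0
  | succ n ih => simpa [Finset.sum_range_succ] using ih.add (h n)

lemma left_inverse {f F : ℂ → ℂ} (hf : AnalyticAt ℂ f 0) (hf0 : f 0 = 0) (hf1 : deriv f 0 = 1)
    (hF : ContinuousAt F 0) (hF0 : F 0 = 0) (h : ∀ᶠ w in nhds 0, f (F w) = w) :
    ∀ᶠ z in nhds 0, F (f z) = z := by
  have hs := hf.hasStrictDerivAt
  have hne : deriv f 0 ≠ 0 := by rw [hf1]; exact one_ne_zero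
  have hl := hs.eventually_left_inverse hne
  have hfc : Filter.Tendsto f (nhds 0) (nhds 0) := by simpa [hf0] using hf.continuousAt.tendsto
  have hFc : Filter.Tendsto F (nhds 0) (nhds 0) := by simpa [hF0] using hF.tendsto
  filter_upwards [hl, hfc.eventually h, (hFc.comp hfc).eventually hl] with z h1 h2 h3
  simp only [Function.comp] at h3
  rw [h2, h1] at h3
  exact h3.symm

lemma tail_rep {F : ℂ → ℂ} {p : PowerSeries ℂ} (h : Rep F p) (N : ℕ) :
    ∃ G : ℂ → ℂ, AnalyticAt ℂ G 0 ∧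
      ∀ᶠ w in nhds 0, F w = ∑ m ∈ Finset.range N, coeff m p * w ^ m + w ^ N * G w := by
  let G : ℂ → ℂ := fun w => ∑' m, coeff (m + N) p * w ^ m
  have key : ∀ᶠ w in nhds (0 : ℂ), Summable (fun m => coeff (m + N) p * w ^ m) := by
    filter_upwards [h] with w hw
    by_cases h0 : w = 0
    · subst h0
      exact summable_of_ne_finset_zero (s := {0}) (fun b hb => by simp at hb; simp [hb])
    · have := ((summable_nat_add_iff N).2 hw.summable).mul_left ((w ^ N)⁻¹)
      refine this.congr fun m => ?_
      have : w ^ N ≠ 0 := pow_ne_zero _ h0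
      rw [pow_add]; field_simp
  refine ⟨G, ?_, ?_⟩
  · have : Rep G (mk fun m => coeff (m + N) p) := by
      filter_upwards [key] with w hw
      simpa using hw.hasSum
    exact this.analyticAt
  · filter_upwards [h, key] with w hw hk
    rw [← hw.tsum_eq, ← hw.summable.sum_add_tsum_nat_add N, ← tsum_mul_left]
    congr 1
    refine tsum_congr fun m => ?_
    rw [pow_add]; ring

lemma lagrange {f F : ℂ → ℂ} {a : ℕ → ℂ} (hf : AnalyticAt ℂ f 0) (hf0 : f 0 = 0) (hf1 : deriv f 0 = 1)
    (hF : IsLocalInverseWithCoeff f F a) :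
    ∃ u g : PowerSeries ℂ, T f = X * u ∧ u * g = 1 ∧ constantCoeff g = 1 ∧
      ∀ n : ℕ, ((n : ℂ) + 1) * a (n + 1) = coeff n (g ^ (n + 1)) := by
  obtain ⟨ha0, -, ρ, hρ, hF⟩ := hF
  have hTf := rep_T hf
  obtain ⟨u, hu⟩ : X ∣ T f := by
    rw [X_dvd_iff, ← coeff_zero_eq_constantCoeff_apply]; simp [T, hf0]
  have hu0 : constantCoeff u = 1 := by
    have : coeff 1 (T f) = 1 := by simp [T, hf1]
    rw [hu, show (1 : ℕ) = 0 + 1 from rfl, coeff_succ_X_mul] at this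
    simpa using this
  have hug : u * u⁻¹ = 1 := PowerSeries.mul_inv_cancel u (by rw [hu0]; exact one_ne_zero)
  refine ⟨u, u⁻¹, hu, hug, ?_, fun n => ?_⟩
  · rw [constantCoeff_inv, hu0, inv_one]
  have hball : ball (0 : ℂ) ρ ∈ nhds 0 := ball_mem_nhds _ hρ
  have hRF : Rep F (mk a) := by
    filter_upwards [hball] with w hw
    simpa using (hF w hw).2.2
  have hF0 : F 0 = 0 := by
    have := (hF 0 (mem_ball_self hρ)).2.2
    have h2 := hasSum_single (f := fun m => a m * (0 : ℂ) ^ m) 0 (fun k hk => by simp [hk])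
    rw [this.unique h2]; simp [ha0]
  have hinv := left_inverse hf hf0 hf1 hRF.analyticAt.continuousAt hF0
    (by filter_upwards [hball] with w hw using (hF w hw).2.1)
  obtain ⟨G, hG, hG'⟩ := tail_rep hRF (n + 2)
  have hGf : AnalyticAt ℂ (fun z => G (f z)) 0 := by
    apply AnalyticAt.fun_comp _ hf; rwa [hf0]
  have hfc : Filter.Tendsto f (nhds 0) (nhds 0) := by simpa [hf0] using hf.continuousAt.tendsto
  have hR := ((rep_sum (fun k => (rep_C (a k)).mul (hTf.pow k)) (n + 2)).add
    ((hTf.pow (n + 2)).mul (rep_T hGf)))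
  have hR2 := hR.congr (g := fun z => z) (by
    filter_upwards [hinv, hfc.eventually hG'] with z h1 h2
    rw [h1] at h2
    conv_rhs => rw [h2]
    simp)
  have hX := rep_X.unique hR2
  refine formal_lagrange (T f) u u⁻¹ hu hug a n ?_
  nth_rewrite 2 [hX]
  rw [add_sub_cancel_left, hu, mul_pow, mul_assoc]
  exact ⟨_, rfl⟩

open MeasureTheory in
lemma schur_r {W : ℂ → ℂ} (hW : DifferentiableOn ℂ W (ball 0 1)) (hb : ∀ z ∈ ball (0 : ℂ) 1, ‖W z‖ ≤ 1)
    (m : ℕ) (p : ℕ → ℂ) (r : ℝ) (hr0 : 0 < r) (hr1 : r < 1) :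
    ∑ k ∈ Finset.range m,
      (‖coeff k (T W * ∑ j ∈ Finset.range m, C (p j) * X ^ j)‖ * r ^ k) ^ 2
      ≤ ∑ j ∈ Finset.range m, ‖p j‖ ^ 2 := by
  have : Fact ((0 : ℝ) < 1) := ⟨one_pos⟩
  set P : PowerSeries ℂ := ∑ j ∈ Finset.range m, C (p j) * X ^ j with hP
  set d : ℕ → ℂ := fun k => coeff k (T W * P) with hd
  have hcP : ∀ k, coeff k P = if k < m then p k else 0 := by
    intro k
    simp [hP, coeff_X_pow]
  have hPs : ∀ z : ℂ, HasSum (fun k => coeff k P * z ^ k) (∑ j ∈ Finset.range m, p j * z ^ j) := by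
    intro z
    have h := hasSum_sum_of_ne_finset_zero (f := fun k => coeff k P * z ^ k) (s := Finset.range m)
      (L := SummationFilter.unconditional ℕ)
      (fun b hb => by
        rw [Finset.mem_range] at hb
        simp [hcP, hb])
    rw [Finset.sum_congr rfl (g := fun j => p j * z ^ j)] at h
    · exact h
    · intro x hx
      rw [Finset.mem_range] at hx
      simp [hcP, hx]
  have hsum : ∀ z ∈ ball (0 : ℂ) 1,
      HasSum (fun k => d k * z ^ k) (W z * ∑ j ∈ Finset.range m, p j * z ^ j) := by
    intro z hz
    refine hasSum_mul ?_ (hPs z)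
    have h := Complex.hasSum_taylorSeries_on_ball hW hz
    have e : (fun k => coeff k (T W) * z ^ k)
        = fun n => ((n.factorial : ℂ))⁻¹ • (z - 0) ^ n • iteratedDeriv n W 0 := by
      funext k
      simp only [T, coeff_mk, sub_zero, smul_eq_mul]; ring
    rw [e]; exact h
  have hrb : (r : ℂ) ∈ ball (0 : ℂ) 1 := by simp [abs_of_pos hr0, hr1]
  have hnorm : Summable (fun k => ‖d k‖ * r ^ k) := by
    simpa [abs_of_pos hr0] using (hsum r hrb).summable.norm
  let φ : ℕ → C(AddCircle (1 : ℝ), ℂ) := fun k => (d k * (r : ℂ) ^ k) • fourier (k : ℤ)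
  have hφ : Summable φ := by
    refine Summable.of_norm (hnorm.congr fun k => ?_)
    simp [φ, norm_smul, fourier_norm, abs_of_pos hr0]
  let Q : C(AddCircle (1 : ℝ), ℂ) := ∑ j ∈ Finset.range m, (p j * (r : ℂ) ^ j) • fourier (j : ℤ)
  have hfour : ∀ (k : ℕ) (t : AddCircle (1 : ℝ)), fourier (k : ℤ) t = (fourier 1 t) ^ k := by
    intro k t
    simp [fourier_apply, AddCircle.toCircle_nsmul]
  have hpt : ∀ t, ‖(∑' k, φ k) t‖ ≤ ‖Q t‖ := by
    intro t
    set e : ℂ := fourier (T := (1 : ℝ)) 1 t with he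
    have hen : ‖e‖ = 1 := by
      rw [he, fourier_apply]; exact Circle.norm_coe _
    have hzb : (r : ℂ) * e ∈ ball (0 : ℂ) 1 := by simp [hen, abs_of_pos hr0, hr1]
    have h1 : HasSum (fun k => φ k t) ((∑' k, φ k) t) := ContinuousMap.hasSum_apply hφ.hasSum t
    have h2 : (∑' k, φ k) t = W (r * e) * ∑ j ∈ Finset.range m, p j * (r * e) ^ j := by
      refine h1.unique ?_
      have h3 := hsum _ hzb
      have : (fun k => φ k t) = fun k => d k * ((r : ℂ) * e) ^ k := by
        funext k
        simp only [φ, ContinuousMap.smul_apply, smul_eq_mul]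
        rw [hfour, mul_pow]; ring
      rw [this]; exact h3
    have h4 : Q t = ∑ j ∈ Finset.range m, p j * (r * e) ^ j := by
      simp only [Q, ContinuousMap.sum_apply, ContinuousMap.smul_apply, smul_eq_mul]
      refine Finset.sum_congr rfl fun j _ => ?_
      rw [hfour, mul_pow]; ring
    rw [h2, h4, norm_mul]
    exact mul_le_of_le_one_left (norm_nonneg _) (hb _ hzb)
  let L := ContinuousMap.toLp (E := ℂ) 2 (AddCircle.haarAddCircle (T := (1 : ℝ))) ℂ
  have hL : ‖L (∑' k, φ k)‖ ≤ ‖L Q‖ := by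
    apply Lp.norm_le_norm_of_ae_le
    filter_upwards [ContinuousMap.coeFn_toLp (p := 2) (𝕜 := ℂ) (AddCircle.haarAddCircle (T := (1 : ℝ))) (∑' k, φ k),
      ContinuousMap.coeFn_toLp (p := 2) (𝕜 := ℂ) (AddCircle.haarAddCircle (T := (1 : ℝ))) Q] with t h1 h2
    rw [h1, h2]; exact hpt t
  have hon0 := orthonormal_fourier (T := (1 : ℝ))
  have hon : Orthonormal ℂ (fun k : ℕ => fourierLp (T := (1 : ℝ)) 2 (k : ℤ)) :=
    hon0.comp (fun k : ℕ => (k : ℤ)) Nat.cast_injective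
  have hite := orthonormal_iff_ite.1 hon
  have hinner : ∀ i : ℕ, inner ℂ (fourierLp (T := (1 : ℝ)) 2 (i : ℤ)) (L (∑' k, φ k)) = d i * (r : ℂ) ^ i := by
    intro i
    have h1 : HasSum (fun k => L (φ k)) (L (∑' k, φ k)) := hφ.hasSum.mapL L
    have h2 := h1.mapL (innerSL ℂ (fourierLp (T := (1 : ℝ)) 2 (i : ℤ)))
    refine h2.unique ?_
    convert hasSum_single i ?_ using 1
    · simp only [φ, map_smul, innerSL_apply_apply, smul_eq_mul]
      have := hite i i
      simp only [if_true] at this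
      rw [this, mul_one]
    · intro k hk
      simp only [φ, map_smul, innerSL_apply_apply, smul_eq_mul]
      have := hite i k
      rw [if_neg (Ne.symm hk)] at this
      rw [this, mul_zero]
  have hbes := hon.sum_inner_products_le (L (∑' k, φ k)) (s := Finset.range m)
  have hQ : ‖L Q‖ ^ 2 = ∑ j ∈ Finset.range m, (‖p j‖ * r ^ j) ^ 2 := by
    have h1 : L Q = ∑ j ∈ Finset.range m, (p j * (r : ℂ) ^ j) • fourierLp (T := (1 : ℝ)) 2 (j : ℤ) := by
      simp only [Q, map_sum, map_smul]; rfl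
    have h2 := hon.inner_sum (fun j => p j * (r : ℂ) ^ j) (fun j => p j * (r : ℂ) ^ j) (Finset.range m)
    rw [← h1, inner_self_eq_norm_sq_to_K] at h2
    have h3 : ((‖L Q‖ ^ 2 : ℝ) : ℂ) = ((∑ j ∈ Finset.range m, (‖p j‖ * r ^ j) ^ 2 : ℝ) : ℂ) := by
      push_cast
      refine h2.trans (Finset.sum_congr rfl fun j _ => ?_)
      rw [← Complex.normSq_eq_conj_mul_self, Complex.normSq_eq_norm_sq]
      simp [abs_of_pos hr0]
    exact_mod_cast h3
  calc _ = ∑ i ∈ Finset.range m, ‖inner ℂ (fourierLp (T := (1 : ℝ)) 2 (i : ℤ)) (L (∑' k, φ k))‖ ^ 2 := by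
        refine Finset.sum_congr rfl fun i _ => ?_
        rw [hinner]; simp [abs_of_pos hr0, hd]
    _ ≤ ‖L (∑' k, φ k)‖ ^ 2 := hbes
    _ ≤ ‖L Q‖ ^ 2 := by gcongr
    _ = _ := hQ
    _ ≤ _ := by
        refine Finset.sum_le_sum fun j _ => ?_
        have : r ^ j ≤ 1 := pow_le_one₀ hr0.le hr1.le
        gcongr
        exact mul_le_of_le_one_right (norm_nonneg _) this

lemma schur {W : ℂ → ℂ} (hW : DifferentiableOn ℂ W (ball 0 1)) (hb : ∀ z ∈ ball (0 : ℂ) 1, ‖W z‖ ≤ 1)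
    (m : ℕ) (p : ℕ → ℂ) :
    ∑ k ∈ Finset.range m, ‖coeff k (T W * ∑ j ∈ Finset.range m, C (p j) * X ^ j)‖ ^ 2
      ≤ ∑ j ∈ Finset.range m, ‖p j‖ ^ 2 := by
  have hcont : Continuous (fun r : ℝ => ∑ k ∈ Finset.range m,
      (‖coeff k (T W * ∑ j ∈ Finset.range m, C (p j) * X ^ j)‖ * r ^ k) ^ 2) := by fun_prop
  have ht := (hcont.tendsto 1).mono_left (nhdsWithin_le_nhds (s := Set.Iio 1))
  simp only [one_pow, mul_one] at ht
  refine le_of_tendsto ht ?_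
  filter_upwards [Ioo_mem_nhdsLT (show (0 : ℝ) < 1 by norm_num)] with r hr
  exact schur_r hW hb m p r hr.1 hr.2

/-- The bounding product. -/
noncomputable def PP (B : ℝ) (n m : ℕ) : ℝ := ∏ j ∈ Finset.range m, (n * (1 - B) + B * j) / (j + 1)

lemma PP_succ (B : ℝ) (n m : ℕ) : ((m : ℝ) + 1) * PP B n (m + 1) = (n * (1 - B) + B * m) * PP B n m := by
  have : (m : ℝ) + 1 ≠ 0 := by positivity
  rw [PP, Finset.prod_range_succ, ← PP]; field_simp

lemma PP_sum (B : ℝ) (n m : ℕ) :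
    ∑ j ∈ Finset.range m, ((n * (1 - B) + B * j) ^ 2 - (j : ℝ) ^ 2) * PP B n j ^ 2 = (m : ℝ) ^ 2 * PP B n m ^ 2 := by
  induction m with
  | zero => simp
  | succ m ih =>
    rw [Finset.sum_range_succ, ih]
    push_cast
    have := PP_succ B n m
    linear_combination (-(((m : ℝ) + 1) * PP B n (m + 1) + (n * (1 - B) + B * m) * PP B n m)) * this

lemma fac_nonneg {B : ℝ} (hB : -1 ≤ B) (hB1 : B < 1) {n j : ℕ} (hj : j ≤ n) :
    (j : ℝ) ≤ n * (1 - B) + B * j := by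
  have : (j : ℝ) ≤ n := by exact_mod_cast hj
  nlinarith

lemma PP_nonneg {B : ℝ} (hB : -1 ≤ B) (hB1 : B < 1) {n m : ℕ} (hm : m ≤ n) : 0 ≤ PP B n m := by
  refine Finset.prod_nonneg fun j hj => ?_
  have h1 := fac_nonneg hB hB1 (show j ≤ n by have := Finset.mem_range.1 hj; omega)
  have : (0 : ℝ) ≤ j := Nat.cast_nonneg j
  exact div_nonneg (by linarith) (by linarith)

lemma coeff_ode (h W : PowerSeries ℂ) (b B : ℂ)
    (hode : X * derivative ℂ h = - (X * (W * (C b * h + C B * (X * derivative ℂ h))))) (k : ℕ) :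
    ((k : ℂ) + 1) * coeff (k + 1) h = - coeff k (W * (C b * h + C B * (X * derivative ℂ h))) := by
  have := congrArg (coeff (k + 1)) hode
  rw [map_neg, coeff_succ_X_mul, coeff_succ_X_mul, coeff_derivative] at this
  rw [← this]; ring

lemma coeff_inner (h : PowerSeries ℂ) (b B : ℂ) (j : ℕ) :
    coeff j (C b * h + C B * (X * derivative ℂ h)) = (b + B * j) * coeff j h := by
  rw [map_add, coeff_C_mul, coeff_C_mul]
  rcases j with _ | j
  · simp
  · rw [coeff_succ_X_mul, coeff_derivative]; push_cast; ring

lemma coeff_trunc (W p : PowerSeries ℂ) (m k : ℕ) (hk : k < m) :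
    coeff k (W * p) = coeff k (W * ∑ j ∈ Finset.range m, C (coeff j p) * X ^ j) := by
  rw [coeff_mul, coeff_mul]
  refine Finset.sum_congr rfl fun x hx => ?_
  have := Finset.HasAntidiagonal.mem_antidiagonal.1 hx
  have h2 : x.2 < m := by omega
  congr 1
  simp [coeff_X_pow, h2]

lemma clunie {B : ℝ} (hB : -1 ≤ B) (hB1 : B < 1) {W : ℂ → ℂ} (hW : DifferentiableOn ℂ W (ball 0 1))
    (hb : ∀ z ∈ ball (0 : ℂ) 1, ‖W z‖ ≤ 1) (n : ℕ) (h : PowerSeries ℂ) (h0 : coeff 0 h = 1)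
    (hode : X * derivative ℂ h = - (X * (T W * (C ((n : ℂ) * (1 - B)) * h + C (B : ℂ) * (X * derivative ℂ h)))))
    (m : ℕ) (hm : m ≤ n) : ‖coeff m h‖ ≤ PP B n m := by
  induction m using Nat.strong_induction_on with
  | _ m ih =>
  rcases m with _ | m
  · rw [h0]; simp [PP]
  have hs := schur hW hb (m + 1) (fun j => coeff j (C ((n : ℂ) * (1 - B)) * h + C (B : ℂ) * (X * derivative ℂ h)))
  have e1 : ∑ k ∈ Finset.range (m + 1), (((k + 1 : ℕ) : ℝ) ^ 2 * ‖coeff (k + 1) h‖ ^ 2) ≤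
      ∑ j ∈ Finset.range (m + 1), (n * (1 - B) + B * j) ^ 2 * ‖coeff j h‖ ^ 2 := by
    refine le_trans (le_of_eq ?_) (hs.trans (le_of_eq ?_))
    · refine Finset.sum_congr rfl fun k hk => ?_
      rw [← coeff_trunc _ _ _ _ (Finset.mem_range.1 hk), ← norm_neg (coeff k _), ← coeff_ode h _ _ _ hode k,
        norm_mul, mul_pow]
      congr 2
      rw [show ((k : ℂ) + 1) = ((k + 1 : ℕ) : ℂ) by push_cast; rfl, Complex.norm_natCast]
    · refine Finset.sum_congr rfl fun j _ => ?_
      rw [coeff_inner, norm_mul, mul_pow]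
      congr 1
      rw [show (n : ℂ) * (1 - B) + B * j = ((n * (1 - B) + B * j : ℝ) : ℂ) by push_cast; rfl,
        Complex.norm_real, Real.norm_eq_abs, sq_abs]
  have e2 : ∑ k ∈ Finset.range (m + 1), (((k + 1 : ℕ) : ℝ) ^ 2 * ‖coeff (k + 1) h‖ ^ 2)
      = ∑ k ∈ Finset.range (m + 1), ((k : ℝ) ^ 2 * ‖coeff k h‖ ^ 2) + ((m + 1 : ℕ) : ℝ) ^ 2 * ‖coeff (m + 1) h‖ ^ 2 := by
    rw [← Finset.sum_range_succ (fun k => (k : ℝ) ^ 2 * ‖coeff k h‖ ^ 2), Finset.sum_range_succ' _ (m + 1)]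
    simp
  have e3 : ((m + 1 : ℕ) : ℝ) ^ 2 * ‖coeff (m + 1) h‖ ^ 2 ≤ ((m + 1 : ℕ) : ℝ) ^ 2 * PP B n (m + 1) ^ 2 := by
    rw [← PP_sum]
    have : ∑ j ∈ Finset.range (m + 1), ((n * (1 - B) + B * j) ^ 2 - (j : ℝ) ^ 2) * ‖coeff j h‖ ^ 2 ≤
      ∑ j ∈ Finset.range (m + 1), ((n * (1 - B) + B * j) ^ 2 - (j : ℝ) ^ 2) * PP B n j ^ 2 := by
      refine Finset.sum_le_sum fun j hj => ?_
      have hj' := Finset.mem_range.1 hj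
      have h1 := fac_nonneg hB hB1 (show j ≤ n by omega)
      have h2 : (0 : ℝ) ≤ j := Nat.cast_nonneg j
      have h3 : (0 : ℝ) ≤ (n * (1 - B) + B * j) ^ 2 - (j : ℝ) ^ 2 := by nlinarith
      have h4 := ih j hj' (by omega)
      gcongr
    refine le_trans ?_ this
    simp only [sub_mul, Finset.sum_sub_distrib]
    linarith
  have e4 := le_of_mul_le_mul_left e3 (by positivity)
  exact (sq_le_sq₀ (norm_nonneg _) (PP_nonneg hB hB1 hm)).1 e4

lemma kernel_coeff {B : ℝ} (hB : -1 ≤ B) (hB1 : B < 1) (n : ℕ) (h : PowerSeries ℂ) (h0 : coeff 0 h = 1)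
    (hode : X * derivative ℂ h = - (X * (1 * (C ((n : ℂ) * (1 - B)) * h + C (B : ℂ) * (X * derivative ℂ h)))))
    (m : ℕ) (hm : m ≤ n) : ‖coeff m h‖ = PP B n m := by
  induction m with
  | zero => rw [h0]; simp [PP]
  | succ m ih =>
    have h1 := congrArg norm (coeff_ode h _ _ _ hode m)
    rw [one_mul, coeff_inner, norm_neg, norm_mul, norm_mul, ih (by omega)] at h1
    rw [show ((m : ℂ) + 1) = ((m + 1 : ℕ) : ℂ) by push_cast; rfl, Complex.norm_natCast,
      show (n : ℂ) * (1 - B) + B * m = ((n * (1 - B) + B * m : ℝ) : ℂ) by push_cast; rfl,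
      Complex.norm_real, Real.norm_eq_abs, abs_of_nonneg] at h1
    · rw [← PP_succ] at h1
      push_cast at h1
      exact mul_left_cancel₀ (by positivity) h1
    · have := fac_nonneg hB hB1 (show m ≤ n by omega)
      exact le_trans (Nat.cast_nonneg m) this

lemma ode_rep {f W : ℂ → ℂ} {B : ℂ} {q : PowerSeries ℂ} (hf : AnalyticAt ℂ f 0) (hW : Rep W q)
    (h : ∀ᶠ z in nhds (0 : ℂ), z * deriv f z * (1 + B * z * W z) = f z * (1 + ((1 : ℝ) : ℂ) * z * W z)) :
    X * derivative ℂ (T f) * (1 + C B * X * q) = T f * (1 + X * q) := by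
  have hT := rep_T hf
  have h1 : Rep _ (X * derivative ℂ (T f) * (C 1 + C B * X * q)) :=
    (rep_X.mul hT.deriv).mul ((rep_C 1).add (((rep_C B).mul rep_X).mul hW))
  have h2 : Rep _ (T f * (C 1 + X * q)) := hT.mul ((rep_C 1).add (rep_X.mul hW))
  have h3 := (h1.congr (by
    filter_upwards [h] with z hz
    rw [hz]; simp)).unique h2
  simpa using h3

lemma kernel_facts (B : ℝ) : AnalyticAt ℂ (janowskiKernel 1 B) 0 ∧ janowskiKernel 1 B 0 = 0 ∧
    deriv (janowskiKernel 1 B) 0 = 1 ∧ ∀ᶠ z in nhds (0 : ℂ), z * deriv (janowskiKernel 1 B) z *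
      (1 + (B : ℂ) * z * 1) = janowskiKernel 1 B z * (1 + ((1 : ℝ) : ℂ) * z * 1) := by
  by_cases hB : B = 0
  · have hk : janowskiKernel 1 B = fun z => z * Complex.exp z := by
      funext z; simp [janowskiKernel, hB]
    have hd : ∀ z, deriv (fun z : ℂ => z * Complex.exp z) z = Complex.exp z + z * Complex.exp z := by
      intro z
      have := ((hasDerivAt_id z).mul (Complex.hasDerivAt_exp z)).deriv
      simpa using this
    rw [hk]
    refine ⟨by fun_prop, by simp, by simp [hd], Filter.Eventually.of_forall fun z => ?_⟩
    rw [hd, hB]; push_cast; ring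
  · have hBc : (B : ℂ) ≠ 0 := by exact_mod_cast hB
    have hk : janowskiKernel 1 B = fun z => z * (1 + (B : ℂ) * z) ^ (1 / (B : ℂ) - 1) := by
      funext z; simp [janowskiKernel, hB]
    have hslit : ∀ᶠ z in nhds (0 : ℂ), 1 + (B : ℂ) * z ∈ Complex.slitPlane := by
      have hc : ContinuousAt (fun z : ℂ => 1 + (B : ℂ) * z) 0 := by fun_prop
      exact hc.eventually (Complex.isOpen_slitPlane.mem_nhds (by simp))
    have hd : ∀ z : ℂ, 1 + (B : ℂ) * z ∈ Complex.slitPlane →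
        HasDerivAt (fun z : ℂ => z * (1 + (B : ℂ) * z) ^ (1 / (B : ℂ) - 1))
        ((1 + (B : ℂ) * z) ^ (1 / (B : ℂ) - 1) + z * ((1 / (B : ℂ) - 1) *
          (1 + (B : ℂ) * z) ^ (1 / (B : ℂ) - 1 - 1) * B)) z := by
      intro z hz
      have h1 : HasDerivAt (fun z : ℂ => 1 + (B : ℂ) * z) B z := by
        simpa using ((hasDerivAt_id z).const_mul (B : ℂ)).const_add 1
      have h2 := (hasDerivAt_id z).mul (h1.cpow_const (c := 1 / (B : ℂ) - 1) hz)
      simp only [id, one_mul] at h2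
      exact h2
    rw [hk]
    refine ⟨?_, by simp, ?_, ?_⟩
    · have h1 : AnalyticAt ℂ (fun z : ℂ => 1 + (B : ℂ) * z) 0 := by fun_prop
      exact analyticAt_id.mul (h1.cpow analyticAt_const (by simp))
    · rw [(hd 0 (by simp)).deriv]; simp
    · filter_upwards [hslit] with z hz
      have hne := Complex.slitPlane_ne_zero hz
      rw [(hd z hz).deriv]
      have hc : (1 / (B : ℂ) - 1) * B = 1 - B := by field_simp
      generalize 1 / (B : ℂ) - 1 = c at hc
      have hp : (1 + (B : ℂ) * z) ^ (c - 1) * (1 + (B : ℂ) * z) = (1 + (B : ℂ) * z) ^ c := by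
        rw [Complex.cpow_sub _ 1 hne, Complex.cpow_one]
        field_simp
      push_cast
      linear_combination (z ^ 2 * c * B) * hp + (z ^ 2 * (1 + (B : ℂ) * z) ^ c) * hc

lemma norm_of_lagrange {a c : ℂ} {n : ℕ} (h : ((n : ℂ) + 1) * a = c) : ‖a‖ = 1 / ((n + 1 : ℕ) : ℝ) * ‖c‖ := by
  rw [← h, norm_mul, show ((n : ℂ) + 1) = ((n + 1 : ℕ) : ℂ) by push_cast; rfl, Complex.norm_natCast]
  have : ((n + 1 : ℕ) : ℝ) ≠ 0 := by positivity
  field_simp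

end JanowskiProof

theorem inverse_coeff_bound_A_eq_one (B : ℝ) (hB : -1 ≤ B) (hB1 : B < 1)
    (f F : ℂ → ℂ) (hf : IsJanowskiStarlike 1 B f)
    (Acoef : ℕ → ℂ) (hFinv : IsLocalInverseWithCoeff f F Acoef)
    (n : ℕ) (hn : 2 ≤ n) :
    ‖Acoef n‖ ≤ (1 / n) * ∏ j ∈ Finset.range (n - 1), (n * (1 - B) + B * j) / (j + 1) ∧
      ∀ F' : ℂ → ℂ, ∀ Acoef' : ℕ → ℂ,
        IsLocalInverseWithCoeff (janowskiKernel 1 B) F' Acoef' →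
          ‖Acoef' n‖ = (1 / n) * ∏ j ∈ Finset.range (n - 1), (n * (1 - B) + B * j) / (j + 1) := by
  obtain ⟨n, rfl⟩ : ∃ k, n = k + 1 := ⟨n - 1, by omega⟩
  simp only [Nat.add_sub_cancel]
  have hball : ball (0 : ℂ) 1 ∈ nhds (0 : ℂ) := ball_mem_nhds _ one_pos
  refine ⟨?_, ?_⟩
  · obtain ⟨hfa, hf0, hf1, ω, hωa, hωb, hode⟩ := hf
    have hfa0 : AnalyticAt ℂ f 0 := (isOpen_ball.analyticOn_iff_analyticOnNhd.1 hfa) 0 (mem_ball_self one_pos)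
    have hωa0 : AnalyticAt ℂ ω 0 := (isOpen_ball.analyticOn_iff_analyticOnNhd.1 hωa) 0 (mem_ball_self one_pos)
    obtain ⟨u, g, hu, hug, hg0, hL⟩ := JanowskiProof.lagrange hfa0 hf0 hf1 hFinv
    rw [JanowskiProof.norm_of_lagrange (hL n)]
    have h1 := JanowskiProof.ode_rep (B := (B : ℂ)) hfa0 (JanowskiProof.rep_T hωa0)
      (Filter.mem_of_superset hball hode)
    have h2 := JanowskiProof.formal_ode _ u g _ _ hu hug h1 n
    gcongr
    refine JanowskiProof.clunie hB hB1 hωa.differentiableOn hωb (n + 1) (g ^ (n + 1)) (by simp [hg0]) ?_ n (by omega)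
    push_cast
    push_cast at h2
    exact h2
  · intro F' a' hF'
    obtain ⟨hk, hk0, hk1, hkode⟩ := JanowskiProof.kernel_facts B
    obtain ⟨u, g, hu, hug, hg0, hL⟩ := JanowskiProof.lagrange hk hk0 hk1 hF'
    rw [JanowskiProof.norm_of_lagrange (hL n)]
    have h1 := JanowskiProof.ode_rep (B := (B : ℂ)) hk (JanowskiProof.rep_C 1) hkode
    rw [map_one] at h1
    have h2 := JanowskiProof.formal_ode _ u g _ _ hu hug h1 n
    congr 1
    refine JanowskiProof.kernel_coeff hB hB1 (n + 1) (g ^ (n + 1)) (by simp [hg0]) ?_ n (by omega)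
    push_cast
    push_cast at h2
    exact h2
end
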